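/- arXiv:2207.01662 — 2 statements merged into one kernel-verified Lean document; each statement's English description precedes it below -/
import Mathlib

section
/- Let α, λᵢ, λⱼ be real numbers with α·λᵢ < 0 and λᵢ·λⱼ > 0, let ρ > λⱼ/λᵢ, and let x₀, y₀, k > 0. Set ρ̃ = (λⱼ − λᵢ·ρ)/α, so ρ̃ > 0. Consider the flow Φ_t(x, y, z) = (x·e^{αt}, y·e^{λᵢt}, z·e^{λⱼt}) of the linear vector field ξ(x, y, z) = (αx, λᵢy, λⱼz). Then for every y with 0 < y < y₀, the time t(y) = ln(y₀/y)/λᵢ is the unique time t ∈ ℝ at which the second coordinate of Φ_t(x₀, y, k·y^ρ) equals y₀, and the point reached is Φ_{t(y)}(x₀, y, k·y^ρ) = (x(y), y₀, z(y)) where x(y) = x₀·(y₀/y)^{α/λᵢ} satisfies 0 < x(y) < x₀ and z(y) = k·y₀^ρ·(x(y)/x₀)^{ρ̃}. In particular, the image under the flow of ξ, on the planar section {y = y₀}, of the curve {(x₀, y, k·y^ρ) : 0 < y < y₀} lies on the graph z = K·x^{ρ̃} with K = k·y₀^ρ·x₀^{−ρ̃}, a curve of quasi-order ρ̃ with respect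 to the x-axis. -/
/-- Linear model of the transition of an angle mark through a corner saddle point
(Proposition 3.9 of the paper). The eigenvalue along the skeleton edge is `α`, the
eigenvalues tangent to the two-dimensional invariant manifold are `λᵢ, λⱼ`, with
`α·λᵢ < 0`, `λᵢ·λⱼ > 0`, and the flow is
`Φ_t(x,y,z) = (x e^{αt}, y e^{λᵢt}, z e^{λⱼt})`. The flow saturation of the curve
`{(x₀, y, k·y^ρ) : 0 < y < y₀}` (an angle mark of quasi-order `ρ > λⱼ/λᵢ`) meets the
planar section `{y = y₀}` along the graph `z = K·x^ρ̃` with `ρ̃ = (λⱼ − λᵢρ)/α > 0` and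
`K = k·y₀^ρ·x₀^{−ρ̃}`. -/
theorem angle_mark_transition_linear (α lamI lamJ ρ x₀ y₀ k : ℝ)
    (h1 : α * lamI < 0) (h2 : 0 < lamI * lamJ) (hρ : lamJ / lamI < ρ)
    (hx : 0 < x₀) (hy : 0 < y₀) (hk : 0 < k) :
    0 < (lamJ - lamI * ρ) / α ∧
    ∀ y : ℝ, 0 < y → y < y₀ →
      -- `t(y) = ln(y₀/y)/λᵢ` is the unique time at which the second coordinate of
      -- `Φ_t(x₀, y, k·y^ρ)` equals `y₀`
      (∀ t : ℝ, y * Real.exp (lamI * t) = y₀ ↔ t = Real.log (y₀ / y) / lamI) ∧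
      -- the first coordinate of the landing point is `x(y) = x₀·(y₀/y)^{α/λᵢ}`
      x₀ * Real.exp (α * (Real.log (y₀ / y) / lamI)) = x₀ * (y₀ / y) ^ (α / lamI) ∧
      0 < x₀ * (y₀ / y) ^ (α / lamI) ∧
      x₀ * (y₀ / y) ^ (α / lamI) < x₀ ∧
      -- the third coordinate of the landing point is `z(y) = k·y₀^ρ·(x(y)/x₀)^ρ̃`
      (k * y ^ ρ) * Real.exp (lamJ * (Real.log (y₀ / y) / lamI))
        = k * y₀ ^ ρ * ((x₀ * (y₀ / y) ^ (α / lamI)) / x₀) ^ ((lamJ - lamI * ρ) / α) ∧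
      -- i.e. the landing point lies on the graph `z = K·x^ρ̃`, `K = k·y₀^ρ·x₀^{−ρ̃}`
      k * y₀ ^ ρ * ((x₀ * (y₀ / y) ^ (α / lamI)) / x₀) ^ ((lamJ - lamI * ρ) / α)
        = (k * y₀ ^ ρ * x₀ ^ (-((lamJ - lamI * ρ) / α)))
            * (x₀ * (y₀ / y) ^ (α / lamI)) ^ ((lamJ - lamI * ρ) / α) := by
  have hα : α ≠ 0 := left_ne_zero_of_mul h1.ne
  have hI : lamI ≠ 0 := right_ne_zero_of_mul h1.ne
  have hexp : ∀ c r : ℝ, 0 < r → Real.exp (c * (Real.log r / lamI)) = r ^ (c / lamI) := by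
    intro c r hr
    rw [Real.rpow_def_of_pos hr]
    congr 1
    ring
  have hratio : α / lamI < 0 := by
    rw [show α / lamI = α * lamI / lamI ^ 2 by field_simp]
    exact div_neg_of_neg_of_pos h1 (by positivity)
  have hρ' : (lamJ - lamI * ρ) / α = (lamJ / lamI - ρ) / (α / lamI) := by
    field_simp
  refine ⟨hρ' ▸ div_pos_of_neg_of_neg (sub_neg.mpr hρ) hratio, fun y hy0 hyy => ?_⟩
  have hr : 0 < y₀ / y := div_pos hy hy0
  have hr1 : 1 < y₀ / y := (one_lt_div hy0).mpr hyy
  have hpow : 0 < (y₀ / y) ^ (α / lamI) := Real.rpow_pos_of_pos hr _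
  rw [hexp α _ hr, hexp lamJ _ hr, mul_div_cancel_left₀ _ hx.ne']
  refine ⟨fun t => ?_, rfl, mul_pos hx hpow,
    mul_lt_of_lt_one_right hx (Real.rpow_lt_one_of_one_lt_of_neg hr1 hratio), ?_, ?_⟩
  · rw [mul_comm y, ← eq_div_iff hy0.ne', eq_div_iff hI, mul_comm t,
      ← Real.exp_eq_exp (x := lamI * t), Real.exp_log hr]
  · rw [← Real.rpow_mul hr.le, hρ', mul_div_cancel₀ _ hratio.ne, Real.rpow_sub hr,
      Real.div_rpow hy.le hy0.le ρ]
    have := Real.rpow_pos_of_pos hy ρ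
    have := Real.rpow_pos_of_pos hy0 ρ
    field_simp
  · rw [Real.mul_rpow hx.le hpow.le, Real.rpow_neg hx.le]
    have := Real.rpow_pos_of_pos hx ((lamJ - lamI * ρ) / α)
    field_simp
end

section
/- Let α, λᵢ, λⱼ be real numbers with α·λᵢ < 0 and λᵢ·λⱼ > 0, and fix y_b > 0, z_b > 0 and x_a > 0. Let γ(s) = (x(s), y(s), z(s)), s ∈ [0, ∞), be a curve with x(s), y(s), z(s) > 0 for all s and γ(s) → (0, y_b, z_b) as s → ∞. For each s put t(s) = ln(x_a/x(s))/α; then t(s) is the unique time t ∈ ℝ at which the first coordinate of Φ_t(γ(s)) equals x_a, where Φ_t(x, y, z) = (x·e^{αt}, y·e^{λᵢt}, z·e^{λⱼt}) is the flow of the linear vector field ξ(x, y, z) = (αx, λᵢy, λⱼz), and the landing point is (x_a, Y(s), Z(s)) with Y(s) = y(s)·(x_a/x(s))^{λᵢ/α} and Z(s) = z(s)·(x_a/x(s))^{λⱼ/α}. Then Y(s) → 0 and Z(s) → 0 as s → ∞, and Z(s)/Y(s)^{λⱼ/λᵢ} → z_b/y_b^{λⱼ/λᵢ}; in particular the landing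 curve s ↦ (Y(s), Z(s)) has quasi-order λⱼ/λᵢ with respect to the first coordinate axis. -/
/-- `HasQuasiOrder γ₁ γ₂ ρ` : the curve `t ↦ (γ₁ t, γ₂ t)` (defined for `t ∈ [0,∞)`)
has quasi-order `ρ` with respect to the x-axis (Definition 3.3 of the paper):
there exist `t₀ ≥ 0` and constants `0 < k₁ < k₂` with
`k₁ · γ₁(t)^ρ < γ₂(t) < k₂ · γ₁(t)^ρ` for all `t ≥ t₀` (real powers). -/
def HasQuasiOrder (γ₁ γ₂ : ℝ → ℝ) (ρ : ℝ) : Prop :=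
  ∃ t₀ k₁ k₂ : ℝ, 0 ≤ t₀ ∧ 0 < k₁ ∧ k₁ < k₂ ∧
    ∀ t : ℝ, t₀ ≤ t → k₁ * γ₁ t ^ ρ < γ₂ t ∧ γ₂ t < k₂ * γ₁ t ^ ρ

/-- A curve with eventually positive first component whose ratio `γ₂ / γ₁ ^ ρ` has a positive
limit has quasi-order `ρ`. -/
theorem HasQuasiOrder.of_tendsto_div {γ₁ γ₂ : ℝ → ℝ} {ρ c : ℝ} (hc : 0 < c)
    (hγ₁ : ∀ᶠ t in Filter.atTop, 0 < γ₁ t)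
    (h : Filter.Tendsto (fun t => γ₂ t / γ₁ t ^ ρ) Filter.atTop (nhds c)) :
    HasQuasiOrder γ₁ γ₂ ρ := by
  have hlower := h.eventually (lt_mem_nhds (half_lt_self hc))
  have hupper := h.eventually (gt_mem_nhds (lt_two_mul_self hc))
  obtain ⟨t₀, ht₀⟩ := Filter.eventually_atTop.1 (hγ₁.and (hlower.and hupper))
  refine ⟨max t₀ 0, c / 2, 2 * c, le_max_right _ _, half_pos hc, by linarith, fun t ht => ?_⟩
  obtain ⟨hpos, hlow, hup⟩ := ht₀ t ((le_max_left _ _).trans ht)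
  have hpow := Real.rpow_pos_of_pos hpos ρ
  exact ⟨(lt_div_iff₀ hpow).1 hlow, (div_lt_iff₀ hpow).1 hup⟩

theorem mul_exp_mul_eq_iff_eq_log_div {a b α : ℝ} (ha : 0 < a) (hb : 0 < b) (hα : α ≠ 0) (t : ℝ) :
    a * Real.exp (α * t) = b ↔ t = Real.log (b / a) / α := by
  rw [eq_div_iff hα, mul_comm t α, ← Real.exp_eq_exp (x := α * t), Real.exp_log (div_pos hb ha),
    eq_div_iff ha.ne', mul_comm a]

theorem exp_mul_log_div_eq_rpow {r : ℝ} (hr : 0 < r) (α μ : ℝ) :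
    Real.exp (μ * (Real.log r / α)) = r ^ (μ / α) := by
  rw [Real.rpow_def_of_pos hr]
  congr 1
  ring

/-- Passing to the ratio `w * r ^ (μ / α) / (v * r ^ (ν / α)) ^ (μ / ν)` removes `r`. -/
theorem mul_rpow_div_mul_rpow_rpow {r v : ℝ} (hr : 0 < r) (hv : 0 < v) (w α μ : ℝ) {ν : ℝ}
    (hν : ν ≠ 0) :
    w * r ^ (μ / α) / (v * r ^ (ν / α)) ^ (μ / ν) = w / v ^ (μ / ν) := by
  have hexp : ν / α * (μ / ν) = μ / α := by field_simp
  rw [Real.mul_rpow hv.le (Real.rpow_nonneg hr.le _), ← Real.rpow_mul hr.le, hexp,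
    mul_div_mul_right _ _ (Real.rpow_pos_of_pos hr _).ne']

theorem tendsto_mul_rpow_zero_of_neg {ι : Type*} {l : Filter ι} {r w : ι → ℝ} {c p : ℝ}
    (hr : Filter.Tendsto r l Filter.atTop) (hw : Filter.Tendsto w l (nhds c)) (hp : p < 0) :
    Filter.Tendsto (fun s => w s * r s ^ p) l (nhds 0) := by
  have hpow := (tendsto_rpow_neg_atTop (neg_pos.2 hp)).comp hr
  simpa [Function.comp_def] using hw.mul hpow

/-- Linear model of the transition of a trace mark (Proposition 3.8 of the paper): a
curve accumulating to a point `(0, y_b, z_b)` of the two-dimensional invariant manifold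
`{x = 0}` of the linear saddle `ξ(x,y,z) = (αx, λᵢy, λⱼz)` (with `α·λᵢ < 0`,
`λᵢ·λⱼ > 0`) is taken by the flow onto a planar section `{x = x_a}` along a curve of
quasi-order `λⱼ/λᵢ`. -/
theorem trace_mark_transition_linear (α lamI lamJ y_b z_b x_a : ℝ)
    (h1 : α * lamI < 0) (h2 : 0 < lamI * lamJ)
    (hyb : 0 < y_b) (hzb : 0 < z_b) (hxa : 0 < x_a)
    (x y z : ℝ → ℝ)
    (hpos : ∀ s : ℝ, 0 ≤ s → 0 < x s ∧ 0 < y s ∧ 0 < z s)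
    (hlim : Filter.Tendsto (fun s => (x s, y s, z s)) Filter.atTop
      (nhds ((0 : ℝ), y_b, z_b))) :
    (∀ s : ℝ, 0 ≤ s →
      -- `t(s) = ln(x_a/x(s))/α` is the unique time at which the first coordinate of
      -- `Φ_t(γ(s))` equals `x_a`
      (∀ t : ℝ, x s * Real.exp (α * t) = x_a ↔ t = Real.log (x_a / x s) / α) ∧
      -- the landing point is `(x_a, Y(s), Z(s))` with
      -- `Y(s) = y(s)·(x_a/x(s))^{λᵢ/α}` and `Z(s) = z(s)·(x_a/x(s))^{λⱼ/α}`
      y s * Real.exp (lamI * (Real.log (x_a / x s) / α))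
        = y s * (x_a / x s) ^ (lamI / α) ∧
      z s * Real.exp (lamJ * (Real.log (x_a / x s) / α))
        = z s * (x_a / x s) ^ (lamJ / α)) ∧
    Filter.Tendsto (fun s => y s * (x_a / x s) ^ (lamI / α)) Filter.atTop
      (nhds (0 : ℝ)) ∧
    Filter.Tendsto (fun s => z s * (x_a / x s) ^ (lamJ / α)) Filter.atTop
      (nhds (0 : ℝ)) ∧
    Filter.Tendsto
      (fun s => (z s * (x_a / x s) ^ (lamJ / α))
        / (y s * (x_a / x s) ^ (lamI / α)) ^ (lamJ / lamI)) Filter.atTop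
      (nhds (z_b / y_b ^ (lamJ / lamI))) ∧
    HasQuasiOrder (fun s => y s * (x_a / x s) ^ (lamI / α))
      (fun s => z s * (x_a / x s) ^ (lamJ / α)) (lamJ / lamI) := by
  have hα : α ≠ 0 := left_ne_zero_of_mul h1.ne
  have hI : lamI ≠ 0 := right_ne_zero_of_mul h1.ne
  have hpI : lamI / α < 0 := by
    rw [div_neg_iff]
    rcases mul_neg_iff.1 h1 with h | h <;> tauto
  have hpJ : lamJ / α < 0 := by
    have hJI : 0 < lamJ / lamI := by
      rw [div_pos_iff]
      rcases mul_pos_iff.1 h2 with h | h <;> tauto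
    have hexp : lamJ / α = lamI / α * (lamJ / lamI) := by field_simp
    exact hexp ▸ mul_neg_of_neg_of_pos hpI hJI
  have hx := hlim.fst_nhds
  have hy := hlim.snd_nhds.fst_nhds
  have hz := hlim.snd_nhds.snd_nhds
  have hr : Filter.Tendsto (fun s => x_a / x s) Filter.atTop Filter.atTop := by
    have hx' : Filter.Tendsto x Filter.atTop (nhdsWithin 0 (Set.Ioi 0)) :=
      tendsto_nhdsWithin_iff.2 ⟨hx, (Filter.eventually_ge_atTop 0).mono fun s hs => (hpos s hs).1⟩
    simpa [div_eq_mul_inv] using hx'.inv_tendsto_nhdsGT_zero.const_mul_atTop hxa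
  have hratio : Filter.Tendsto
      (fun s => (z s * (x_a / x s) ^ (lamJ / α))
        / (y s * (x_a / x s) ^ (lamI / α)) ^ (lamJ / lamI)) Filter.atTop
      (nhds (z_b / y_b ^ (lamJ / lamI))) := by
    refine (hz.div (hy.rpow_const (Or.inl hyb.ne')) (Real.rpow_pos_of_pos hyb _).ne').congr' ?_
    filter_upwards [Filter.eventually_ge_atTop 0] with s hs
    obtain ⟨hxs, hys, -⟩ := hpos s hs
    exact (mul_rpow_div_mul_rpow_rpow (div_pos hxa hxs) hys _ _ _ hI).symm
  refine ⟨fun s hs => ?_, tendsto_mul_rpow_zero_of_neg hr hy hpI,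
    tendsto_mul_rpow_zero_of_neg hr hz hpJ, hratio, ?_⟩
  · have hxs := (hpos s hs).1
    have hrs := div_pos hxa hxs
    exact ⟨mul_exp_mul_eq_iff_eq_log_div hxs hxa hα, by rw [exp_mul_log_div_eq_rpow hrs],
      by rw [exp_mul_log_div_eq_rpow hrs]⟩
  · refine HasQuasiOrder.of_tendsto_div (div_pos hzb (Real.rpow_pos_of_pos hyb _)) ?_ hratio
    filter_upwards [Filter.eventually_ge_atTop 0] with s hs
    obtain ⟨hxs, hys, -⟩ := hpos s hs
    exact mul_pos hys (Real.rpow_pos_of_pos (div_pos hxa hxs) _)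
end
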